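/- arXiv:0907.4237 — 8 statements merged into one kernel-verified Lean document; each statement's English description precedes it below -/
import Mathlib

section
/- The independence relation induced by a finitary matroid is a symmetric pre-independence relation: let cl be a finitary matroid on a type α and let ⫫ denote the induced relation. Then ⫫ satisfies (Monotonicity) if A ⫫_C B, A' ⊆ A and B' ⊆ B then A' ⫫_C B'; (Base Monotonicity) if D ⊆ C ⊆ B and A ⫫_D B then A ⫫_C B; (Transitivity) if D ⊆ C ⊆ B, B ⫫_C A and C ⫫_D A then B ⫫_D A; (Normality) if A ⫫_C B then A ∪ C ⫫_C B; (Finite Character) if A₀ ⫫_C B for every finite A₀ ⊆ A then A ⫫_C B; and (Symmetry) A ⫫_C B iff B ⫫_C A. -/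
open Set

/-- A finitary matroid (pregeometry) on `α`: a closure operator satisfying
extension, monotonicity, idempotency, finitary character, and the exchange principle. -/
structure IsFinMatroid {α : Type*} (cl : Set α → Set α) : Prop where
  subset_cl : ∀ X : Set α, X ⊆ cl X
  mono : ∀ ⦃X Y : Set α⦄, X ⊆ Y → cl X ⊆ cl Y
  idem : ∀ X : Set α, cl (cl X) = cl X
  finitary : ∀ X : Set α, cl X = ⋃ A ∈ {A : Set α | A ⊆ X ∧ A.Finite}, cl A
  exchange : ∀ ⦃X : Set α⦄ ⦃a c : α⦄, a ∈ cl (X ∪ {c}) → a ∉ cl X → c ∈ cl (X ∪ {a})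

/-- `ClIndep cl B S` : the set `S` is `cl`-independent over `B`. -/
def ClIndep {α : Type*} (cl : Set α → Set α) (B S : Set α) : Prop :=
  ∀ a ∈ S, a ∉ cl (B ∪ (S \ {a}))

/-- `ClInd cl A B C` means `A ⫫_B C` : every `Z' ⊆ C` that is `cl`-independent over `B`
is also `cl`-independent over `B ∪ A`. -/
def ClInd {α : Type*} (cl : Set α → Set α) (A B C : Set α) : Prop :=
  ∀ Z' : Set α, Z' ⊆ C → ClIndep cl B Z' → ClIndep cl (B ∪ A) Z'

/-- The relative rank `RK(A/B)`: the supremum of the cardinalities of subsets of `A`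
that are `cl`-independent over `B`. -/
noncomputable def ClRK {α : Type*} (cl : Set α → Set α) (A B : Set α) : Cardinal :=
  ⨆ S : {S : Set α // S ⊆ A ∧ ClIndep cl B S}, Cardinal.mk S.1

namespace IsFinMatroid

variable {α : Type*} {cl : Set α → Set α}

/-- Membership in the closure of `X ∪ A` is witnessed by a finite part of `A`. -/
theorem exists_finite_subset_mem_cl_union (hcl : IsFinMatroid cl) {X A : Set α} {z : α}
    (hz : z ∈ cl (X ∪ A)) : ∃ A₀ ⊆ A, A₀.Finite ∧ z ∈ cl (X ∪ A₀) := by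
  rw [hcl.finitary] at hz
  simp only [mem_iUnion, mem_ofPred_eq, exists_prop] at hz
  obtain ⟨F, ⟨hFs, hF⟩, hzF⟩ := hz
  refine ⟨F ∩ A, inter_subset_right, hF.inter_of_left A, hcl.mono ?_ hzF⟩
  intro x hx
  exact (hFs hx).imp id fun hA => ⟨hx, hA⟩

/-- Membership in the closure of `X ∪ A` is witnessed by a minimal part of `A`. -/
theorem exists_minimal_subset_mem_cl_union (hcl : IsFinMatroid cl) {X A : Set α} {z : α}
    (hz : z ∈ cl (X ∪ A)) :
    ∃ A₀ ⊆ A, z ∈ cl (X ∪ A₀) ∧ ∀ a ∈ A₀, z ∉ cl (X ∪ (A₀ \ {a})) := by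
  obtain ⟨A₁, hA₁, hfin, hz₁⟩ := hcl.exists_finite_subset_mem_cl_union hz
  have hcand : {S | S ⊆ A₁ ∧ z ∈ cl (X ∪ S)}.Finite :=
    hfin.finite_subsets.subset fun _ h => h.1
  obtain ⟨A₀, ⟨hsub, hz₀⟩, hmin⟩ := hcand.exists_minimal ⟨A₁, Subset.rfl, hz₁⟩
  refine ⟨A₀, hsub.trans hA₁, hz₀, fun a ha hza => ?_⟩
  exact (hmin ⟨sdiff_subset.trans hsub, hza⟩ sdiff_subset ha).2 rfl

theorem cl_subset_cl (hcl : IsFinMatroid cl) {X Y : Set α} (h : X ⊆ cl Y) : cl X ⊆ cl Y :=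
  (hcl.mono h).trans (hcl.idem Y).subset

theorem clIndep_of_base_subset (hcl : IsFinMatroid cl) {B C S : Set α} (h : B ⊆ C)
    (hS : ClIndep cl C S) : ClIndep cl B S :=
  fun a ha haB => hS a ha (hcl.mono (union_subset_union_left _ h) haB)

theorem clInd_symm (hcl : IsFinMatroid cl) {A B C : Set α} (h : ClInd cl B C A) :
    ClInd cl A C B := by
  intro Z hZB hZ z hz hzA
  rw [union_right_comm] at hzA
  obtain ⟨A₀, hA₀, hz₀, hmin⟩ := hcl.exists_minimal_subset_mem_cl_union hzA
  have hA₀ind : ClIndep cl (C ∪ Z \ {z}) A₀ := by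
    intro a ha hacl
    refine hmin a ha (hcl.cl_subset_cl ?_ hz₀)
    rintro x (hx | hx)
    · exact hcl.subset_cl _ (Or.inl hx)
    · by_cases hxa : x = a
      · exact hxa ▸ hacl
      · exact hcl.subset_cl _ (Or.inr ⟨hx, hxa⟩)
  have hA₀B := h A₀ hA₀ (hcl.clIndep_of_base_subset subset_union_left hA₀ind)
  obtain rfl | ⟨a, ha⟩ := A₀.eq_empty_or_nonempty
  · exact hZ z hz (by simpa using hz₀)
  · have hexch : a ∈ cl ((C ∪ Z \ {z}) ∪ A₀ \ {a} ∪ {z}) := by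
      refine hcl.exchange ?_ (hmin a ha)
      rwa [union_assoc, sdiff_union_of_subset (singleton_subset_iff.2 ha)]
    refine hA₀B a ha (hcl.mono ?_ hexch)
    rintro x (((hx | hx) | hx) | rfl)
    · exact Or.inl (Or.inl hx)
    · exact Or.inl (Or.inr (hZB hx.1))
    · exact Or.inr hx
    · exact Or.inl (Or.inr (hZB hz))

end IsFinMatroid

/-- The independence relation induced by a finitary matroid is a symmetric
pre-independence relation: it satisfies Monotonicity, Base Monotonicity,
Transitivity, Normality, Finite Character, and Symmetry.
Here `ClInd cl A C B` means `A ⫫_C B`. -/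
theorem clInd_symmetric_preIndepRel {α : Type*} {cl : Set α → Set α}
    (hcl : IsFinMatroid cl) :
    -- Monotonicity
    (∀ A A' B B' C : Set α, ClInd cl A C B → A' ⊆ A → B' ⊆ B → ClInd cl A' C B') ∧
    -- Base Monotonicity
    (∀ A B C D : Set α, D ⊆ C → C ⊆ B → ClInd cl A D B → ClInd cl A C B) ∧
    -- Transitivity
    (∀ A B C D : Set α, D ⊆ C → C ⊆ B → ClInd cl B C A → ClInd cl C D A → ClInd cl B D A) ∧
    -- Normality
    (∀ A B C : Set α, ClInd cl A C B → ClInd cl (A ∪ C) C B) ∧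
    -- Finite Character
    (∀ A B C : Set α, (∀ A₀ : Set α, A₀ ⊆ A → A₀.Finite → ClInd cl A₀ C B) → ClInd cl A C B) ∧
    -- Symmetry
    (∀ A B C : Set α, ClInd cl A C B ↔ ClInd cl B C A) := by
  refine ⟨?_, ?_, ?_, ?_, ?_, fun A B C => ⟨hcl.clInd_symm, hcl.clInd_symm⟩⟩
  · intro A A' B B' C h hA hB Z hZ hind
    exact hcl.clIndep_of_base_subset (union_subset_union_right C hA) (h Z (hZ.trans hB) hind)
  · intro A B C D hDC hCB h
    refine hcl.clInd_symm fun S hS hind => ?_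
    have := hcl.clInd_symm h S hS (hcl.clIndep_of_base_subset hDC hind)
    rwa [union_eq_right.2 (hDC.trans hCB), ← union_eq_right.2 hCB] at this
  · intro A B C D hDC hCB hBC hCD S hS hind
    have hC := hCD S hS hind
    rw [union_eq_right.2 hDC] at hC
    exact hcl.clIndep_of_base_subset (union_subset_union_left B hDC) (hBC S hS hC)
  · intro A B C h
    rwa [ClInd, union_left_comm, union_self, union_comm A C]
  · intro A B C h Z hZ hind z hz hzA
    rw [union_right_comm] at hzA
    obtain ⟨A₀, hA₀, hfin, hz₀⟩ := hcl.exists_finite_subset_mem_cl_union hzA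
    rw [union_right_comm] at hz₀
    exact h A₀ hA₀ hfin Z hZ hind z hz hz₀
end

section
/- Let cl be a finitary matroid on a type α and let ⫫ be the induced independence relation. If X ⫫_Y Z, then cl(X ∪ Y) ∩ cl(Z ∪ Y) = cl(Y). -/
open Set

/-- A point in the closure of `Z ∪ Y` lies in the closure of `Y ∪ S` for some finite `S ⊆ Z`
from which no element can be dropped. -/
theorem IsFinMatroid.exists_minimal_finset {α : Type*} {cl : Set α → Set α}
    (hcl : IsFinMatroid cl) {Y Z : Set α} {a : α} (ha : a ∈ cl (Z ∪ Y)) :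
    ∃ S : Finset α, (S : Set α) ⊆ Z ∧ a ∈ cl (Y ∪ S) ∧
      ∀ s ∈ S, a ∉ cl (Y ∪ ((S : Set α) \ {s})) := by
  classical
  rw [hcl.finitary] at ha
  simp only [mem_iUnion, mem_ofPred_eq, exists_prop] at ha
  obtain ⟨A, ⟨hAZY, hA⟩, haA⟩ := ha
  have hex : ∃ S : Finset α, (S : Set α) ⊆ Z ∧ a ∈ cl (Y ∪ S) := by
    refine ⟨(hA.inter_of_left Z).toFinset, by simp, hcl.mono (fun x hx => ?_) haA⟩
    rcases hAZY hx with hZ | hY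
    · exact Or.inr (by simp [hx, hZ])
    · exact Or.inl hY
  obtain ⟨S, hS⟩ := exists_minimal_of_wellFoundedLT _ hex
  refine ⟨S, hS.prop.1, hS.prop.2, fun s hs has => ?_⟩
  have hle := hS.le_of_le (y := S.erase s)
    ⟨fun x hx => hS.prop.1 (Finset.mem_of_mem_erase hx), by rwa [Finset.coe_erase]⟩
    (Finset.erase_subset s S)
  exact Finset.notMem_erase s S (hle hs)

/-- If `X ⫫_Y Z` (w.r.t. a finitary matroid `cl`), then
`cl(X ∪ Y) ∩ cl(Z ∪ Y) = cl(Y)`. -/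
theorem clInd_inter_closure {α : Type*} {cl : Set α → Set α} (hcl : IsFinMatroid cl)
    {X Y Z : Set α} (h : ClInd cl X Y Z) :
    cl (X ∪ Y) ∩ cl (Z ∪ Y) = cl Y := by
  apply Subset.antisymm
  · rintro a ⟨haX, haZ⟩
    by_contra haY
    obtain ⟨S, hSZ, haS, hmin⟩ := hcl.exists_minimal_finset haZ
    have hind : ClIndep cl Y S := by
      intro s hs hscl
      refine hmin s hs ?_
      rw [← hcl.idem]
      refine hcl.mono (fun x hx => ?_) haS
      by_cases hxs : x = s
      · exact hxs ▸ hscl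
      · exact hcl.subset_cl _ (hx.imp_right fun hxS => ⟨hxS, hxs⟩)
    obtain ⟨s, hs⟩ : S.Nonempty := by
      rw [Finset.nonempty_iff_ne_empty]
      rintro rfl
      exact haY (by simpa using haS)
    have hex : s ∈ cl ((Y ∪ ((S : Set α) \ {s})) ∪ {a}) := by
      refine hcl.exchange (hcl.mono (fun x hx => ?_) haS) (hmin s hs)
      by_cases hxs : x = s
      · exact Or.inr hxs
      · exact Or.inl (hx.imp_right fun hxS => ⟨hxS, hxs⟩)
    refine h S hSZ hind s hs ?_
    rw [← hcl.idem]
    refine hcl.mono ?_ hex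
    rintro x ((hx | hx) | rfl)
    · exact hcl.subset_cl _ (Or.inl (Or.inl hx))
    · exact hcl.subset_cl _ (Or.inr hx)
    · exact hcl.mono (union_comm X Y ▸ subset_union_left) haX
  · exact subset_inter (hcl.mono subset_union_right) (hcl.mono subset_union_right)
end

section
/- Let ⫫ be a symmetric pre-independence relation on an infinite set X, and let A, B, C, D ⊆ X. If A ⫫_C D and A ∪ D ⫫_C B, then A ⫫_C (B ∪ D) and D ⫫_C (B ∪ A). -/
open Set

/-- A pre-independence relation on `X`: `Ind A C B` means `A ⫫_C B`.
It satisfies Monotonicity, Base Monotonicity, Transitivity, Normality,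
and Finite Character. -/
structure PreIndepRel (X : Type*) where
  Ind : Set X → Set X → Set X → Prop
  mono : ∀ ⦃A A' B B' C : Set X⦄, Ind A C B → A' ⊆ A → B' ⊆ B → Ind A' C B'
  baseMono : ∀ ⦃A B C D : Set X⦄, D ⊆ C → C ⊆ B → Ind A D B → Ind A C B
  trans : ∀ ⦃A B C D : Set X⦄, D ⊆ C → C ⊆ B → Ind B C A → Ind C D A → Ind B D A
  normal : ∀ ⦃A B C : Set X⦄, Ind A C B → Ind (A ∪ C) C B
  finChar : ∀ ⦃A B C : Set X⦄, (∀ A₀ : Set X, A₀ ⊆ A → A₀.Finite → Ind A₀ C B) → Ind A C B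

/-- A pre-independence relation is symmetric if `A ⫫_C B ↔ B ⫫_C A`. -/
def PreIndepRel.Symmetric {X : Type*} (R : PreIndepRel X) : Prop :=
  ∀ A B C : Set X, R.Ind A C B ↔ R.Ind B C A

theorem PreIndepRel.ind_union_right {X : Type*} (R : PreIndepRel X) (hsym : R.Symmetric)
    {A B C D : Set X} (h1 : R.Ind A C D) (h2 : R.Ind (A ∪ D) C B) : R.Ind A C (B ∪ D) := by
  have hB : R.Ind B C (A ∪ D ∪ C) := (hsym _ _ _).1 (R.normal h2)
  have hDC : D ∪ C ⊆ A ∪ D ∪ C := union_subset_union_left C subset_union_right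
  have hBDC : R.Ind (B ∪ (D ∪ C)) (D ∪ C) A :=
    R.mono (R.normal (R.baseMono subset_union_right hDC hB)) subset_rfl
      (subset_union_left.trans subset_union_left)
  have hD : R.Ind (D ∪ C) C A := R.normal ((hsym _ _ _).1 h1)
  have h : R.Ind (B ∪ (D ∪ C)) C A := R.trans subset_union_right subset_union_right hBDC hD
  exact R.mono ((hsym _ _ _).1 h) subset_rfl (union_subset_union_right B subset_union_left)

/-- For a symmetric pre-independence relation on an infinite set:
if `A ⫫_C D` and `A ∪ D ⫫_C B`, then `A ⫫_C (B ∪ D)` and `D ⫫_C (B ∪ A)`. -/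
theorem preIndepRel_union {X : Type*} [Infinite X] (R : PreIndepRel X)
    (hsym : R.Symmetric) {A B C D : Set X}
    (h1 : R.Ind A C D) (h2 : R.Ind (A ∪ D) C B) :
    R.Ind A C (B ∪ D) ∧ R.Ind D C (B ∪ A) := by
  exact ⟨R.ind_union_right hsym h1 h2,
    R.ind_union_right hsym ((hsym _ _ _).1 h1) (union_comm A D ▸ h2)⟩
end

section
/- Independent sequences for a symmetric pre-independence relation: let ⫫ be a symmetric pre-independence relation on an infinite set X, let (I, ≤) be a linearly ordered set, let (A_i)_{i ∈ I} be a family of finite subsets of X, and let C ⊆ X. Then the following are equivalent: (1) for every i ∈ I, A_i ⫫_C ⋃_{j < i} A_j; (2) for every i ∈ I, A_i ⫫_C ⋃_{j ≠ i} A_j. -/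
open Set

namespace PreIndepRel

variable {X : Type*} {R : PreIndepRel X}

/-- If `A ⫫_C S ∪ T` and `S ⫫_C T`, then `A ∪ S ⫫_C T`. -/
theorem Symmetric.union_left (hsym : R.Symmetric) {A S T C : Set X}
    (h : R.Ind A C (S ∪ T)) (hST : R.Ind S C T) : R.Ind (A ∪ S) C T := by
  have hbase : R.Ind A (S ∪ C) ((S ∪ T) ∪ C) :=
    R.baseMono subset_union_right (union_subset_union_left C subset_union_left)
      ((hsym _ _ _).1 (R.normal ((hsym _ _ _).1 h)))
  have hbig : R.Ind (A ∪ (S ∪ C)) (S ∪ C) T :=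
    R.normal (R.mono hbase Subset.rfl (subset_union_right.trans subset_union_left))
  exact R.mono (R.trans subset_union_right subset_union_right hbig (R.normal hST))
    (union_subset_union_right A subset_union_left) Subset.rfl

/-- If each term of a sequence is independent from the union of the preceding ones, then
finite unions over disjoint sets of indices are independent. -/
theorem Symmetric.ind_biUnion_of_disjoint (hsym : R.Symmetric) {I : Type*} [LinearOrder I]
    [Nonempty I] {A : I → Set X} {C : Set X} (h : ∀ i, R.Ind (A i) C (⋃ j < i, A j))
    {s t : Finset I} (hst : Disjoint s t) : R.Ind (⋃ j ∈ s, A j) C (⋃ j ∈ t, A j) := by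
  suffices H : ∀ u s t : Finset I, s ⊆ u → t ⊆ u → Disjoint s t →
      R.Ind (⋃ j ∈ s, A j) C (⋃ j ∈ t, A j) from
    H (s ∪ t) s t Finset.subset_union_left Finset.subset_union_right hst
  clear hst s t
  intro u
  induction u using Finset.induction_on_max with
  | empty =>
    intro s t hs ht _
    rw [Finset.subset_empty.1 hs, Finset.subset_empty.1 ht]
    exact R.mono (h (Classical.arbitrary I)) (by simp) (by simp)
  | insert m u hm ih =>
    have key : ∀ s t : Finset I, s ⊆ insert m u → t ⊆ insert m u → Disjoint s t → m ∈ s →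
        R.Ind (⋃ j ∈ s, A j) C (⋃ j ∈ t, A j) := by
      intro s t hs ht hst hms
      have hs' : s.erase m ⊆ u := Finset.subset_insert_iff.1 hs
      have ht' : t ⊆ u :=
        (Finset.subset_insert_iff_of_notMem (Finset.disjoint_left.1 hst hms)).1 ht
      have hrest := ih _ _ hs' ht' (hst.mono_left (Finset.erase_subset m s))
      have hlast : R.Ind (A m) C ((⋃ j ∈ s.erase m, A j) ∪ ⋃ j ∈ t, A j) :=
        R.mono (h m) Subset.rfl (union_subset
          (biUnion_subset_biUnion_left fun j hj => hm j (hs' hj))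
          (biUnion_subset_biUnion_left fun j hj => hm j (ht' hj)))
      rw [← Finset.insert_erase hms, Finset.set_biUnion_insert]
      exact hsym.union_left hlast hrest
    intro s t hs ht hst
    by_cases hms : m ∈ s
    · exact key s t hs ht hst hms
    by_cases hmt : m ∈ t
    · exact (hsym _ _ _).1 (key t s ht hs hst.symm hmt)
    exact ih s t ((Finset.subset_insert_iff_of_notMem hms).1 hs)
      ((Finset.subset_insert_iff_of_notMem hmt).1 ht) hst

end PreIndepRel


/-- Independent sequences for a symmetric pre-independence relation on an infinite set:
for a family `(A i)` of finite sets indexed by a linear order,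
`A i ⫫_C ⋃_{j < i} A j` for all `i` iff `A i ⫫_C ⋃_{j ≠ i} A j` for all `i`. -/
theorem preIndepRel_indep_sequence {X : Type*} [Infinite X] (R : PreIndepRel X)
    (hsym : R.Symmetric) {I : Type*} [LinearOrder I] (A : I → Set X)
    (hA : ∀ i, (A i).Finite) (C : Set X) :
    (∀ i : I, R.Ind (A i) C (⋃ j ∈ {j : I | j < i}, A j)) ↔
      (∀ i : I, R.Ind (A i) C (⋃ j ∈ {j : I | j ≠ i}, A j)) := by
  constructor
  · intro h i
    have : Nonempty I := ⟨i⟩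
    refine (hsym _ _ _).1 (R.finChar fun A₀ hA₀ hfin => ?_)
    have hcover : ∀ x ∈ A₀, ∃ j, j ≠ i ∧ x ∈ A j := fun x hx => by simpa using hA₀ hx
    choose! f hne hmem using hcover
    have hdisj : Disjoint (hfin.toFinset.image f) {i} := by
      simpa using fun x hx => hne x hx
    refine R.mono (hsym.ind_biUnion_of_disjoint h hdisj) (fun x hx => ?_) (by simp)
    exact mem_biUnion (Finset.mem_image_of_mem f (hfin.mem_toFinset.2 hx)) (hmem x hx)
  · exact fun h i => R.mono (h i) Subset.rfl (biUnion_subset_biUnion_left fun _ hj => ne_of_lt hj)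
end

section
/- Let cl be a finitary matroid on a type α and let ⫫ be the induced independence relation. Let (a_i)_{i ∈ I} be a family of elements of α, C ⊆ α, and set J := {i ∈ I : a_i ∉ cl(C)}. Then the family (a_i)_{i ∈ I} is an independent sequence over C with respect to ⫫ (i.e., {a_i} ⫫_C {a_j : j ≠ i} for every i ∈ I) if and only if the map i ↦ a_i is injective on J and the set {a_j : j ∈ J} is cl-independent over C. -/
open Set

section

variable {α : Type*} {cl : Set α → Set α}

theorem IsFinMatroid.cl_subset_cl_s8 (hcl : IsFinMatroid cl) {X Y : Set α} (h : X ⊆ cl Y) :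
    cl X ⊆ cl Y :=
  hcl.idem Y ▸ hcl.mono h

/-- Any element of `cl (B ∪ X)` lies in `cl (B ∪ A)` for some finite `A ⊆ X` that is minimal with
this property. -/
theorem IsFinMatroid.exists_minimal_finset_s8 (hcl : IsFinMatroid cl) {B X : Set α} {x : α}
    (hx : x ∈ cl (B ∪ X)) :
    ∃ A : Finset α, Minimal (fun A : Finset α => (A : Set α) ⊆ X ∧ x ∈ cl (B ∪ A)) A := by
  classical
  apply exists_minimal_of_wellFoundedLT
  rw [hcl.finitary] at hx
  simp only [mem_iUnion, mem_ofPred_eq] at hx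
  obtain ⟨F, ⟨hFX, hF⟩, hxF⟩ := hx
  refine ⟨(hF.inter_of_left X).toFinset, by simp, hcl.mono ?_ hxF⟩
  intro y hy
  rcases hFX hy with h | h
  · exact .inl h
  · exact .inr (by simp [hy, h])

/-- An element outside `cl B` that is independent over `B` from `X` is not in `cl (B ∪ X)`. -/
theorem ClInd.notMem_cl_union (hcl : IsFinMatroid cl) {B X : Set α} {x : α}
    (h : ClInd cl {x} B X) (hxB : x ∉ cl B) : x ∉ cl (B ∪ X) := by
  classical
  intro hx
  obtain ⟨A, ⟨hAX, hxA⟩, hmin⟩ := hcl.exists_minimal_finset_s8 hx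
  have hxz : ∀ z ∈ A, x ∉ cl (B ∪ ((A : Set α) \ {z})) := by
    intro z hz hxz
    have := hmin (y := A.erase z)
      ⟨(Finset.coe_subset.2 (A.erase_subset z)).trans hAX, by simpa using hxz⟩ (A.erase_subset z) hz
    simp at this
  have hins : ∀ z ∈ A, B ∪ ((A : Set α) \ {z}) ∪ {z} = B ∪ A := by
    intro z hz
    rw [union_assoc, sdiff_union_of_subset (by simpa using hz)]
  have hind : ClIndep cl B A := by
    intro z hz hzA
    refine hxz z hz (hcl.cl_subset_cl_s8 ?_ hxA)
    rw [← hins z hz]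
    exact union_subset (hcl.subset_cl _) (singleton_subset_iff.2 hzA)
  obtain rfl | ⟨z, hz⟩ := A.eq_empty_or_nonempty
  · simp [hxB] at hxA
  · refine h A hAX hind z hz ?_
    rw [union_right_comm]
    exact hcl.exchange (by rwa [hins z hz]) (hxz z hz)

/-- Independence over `B` is unaffected by adding to `B` an element of its closure. -/
theorem ClIndep.union_singleton_of_mem_cl (hcl : IsFinMatroid cl) {B S : Set α} {x : α}
    (h : ClIndep cl B S) (hx : x ∈ cl B) : ClIndep cl (B ∪ {x}) S := by
  intro z hz hzS
  refine h z hz (hcl.cl_subset_cl_s8 ?_ hzS)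
  refine union_subset (union_subset ?_ ?_) ?_
  · exact subset_union_left.trans (hcl.subset_cl _)
  · exact singleton_subset_iff.2 (hcl.mono subset_union_left hx)
  · exact subset_union_right.trans (hcl.subset_cl _)

end

/-- A family `(a i)` is an independent sequence over `C` w.r.t. the induced
independence relation (i.e. `{a i} ⫫_C {a j : j ≠ i}` for every `i`) iff,
setting `J := {i | a i ∉ cl C}`, the map `i ↦ a i` is injective on `J` and
the set `{a j : j ∈ J}` is `cl`-independent over `C`. -/
theorem clInd_indep_sequence_iff {α : Type*} {cl : Set α → Set α}
    (hcl : IsFinMatroid cl) {I : Type*} (a : I → α) (C : Set α) :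
    (∀ i : I, ClInd cl {a i} C (a '' {j : I | j ≠ i})) ↔
      (Set.InjOn a {i : I | a i ∉ cl C} ∧
        ClIndep cl C (a '' {i : I | a i ∉ cl C})) := by
  constructor
  · intro h
    refine ⟨fun i hi j hj hij => ?_, ?_⟩
    · by_contra hne
      refine (h i).notMem_cl_union hcl hi (hcl.subset_cl _ (.inr ?_))
      exact ⟨j, Ne.symm hne, hij.symm⟩
    · rintro _ ⟨i, hi, rfl⟩ hmem
      refine (h i).notMem_cl_union hcl hi (hcl.mono (union_subset_union_right C ?_) hmem)
      rintro _ ⟨⟨j, -, rfl⟩, hne⟩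
      exact ⟨j, fun hji => hne (congrArg a hji), rfl⟩
  · rintro ⟨hinj, hind⟩ i Z hZ hZind
    by_cases hi : a i ∈ cl C
    · exact hZind.union_singleton_of_mem_cl hcl hi
    have hZC : ∀ z ∈ Z, z ∉ cl C := fun z hz hzC => hZind z hz (hcl.mono subset_union_left hzC)
    have hZJ : Z ⊆ a '' {i | a i ∉ cl C} := by
      intro z hz
      obtain ⟨j, -, rfl⟩ := hZ hz
      exact ⟨j, hZC _ hz, rfl⟩
    intro z hz hmem
    refine hind z (hZJ hz) (hcl.mono ?_ hmem)
    rw [union_assoc]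
    refine union_subset_union_right C (union_subset ?_ (sdiff_subset_sdiff_left hZJ))
    obtain ⟨j, hj, rfl⟩ := hZ hz
    exact singleton_subset_iff.2 ⟨⟨i, hi, rfl⟩, fun hij => hj (hinj (hZC _ hz) hi hij.symm)⟩
end

section
/- Comparison of matroids via relative rank: let cl and cl' be two finitary matroids on the same type α. Then cl X ⊆ cl' X for every X ⊆ α if and only if RK^{cl}(A/B) ≥ RK^{cl'}(A/B) for all finite A ⊆ α and all B ⊆ α. Consequently, cl = cl' if and only if RK^{cl}(A/B) = RK^{cl'}(A/B) for all finite A ⊆ α and all B ⊆ α. -/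
open Set

theorem ClIndep.of_cl_subset {α : Type*} {cl cl' : Set α → Set α}
    (h : ∀ X : Set α, cl X ⊆ cl' X) {B S : Set α} (hS : ClIndep cl' B S) :
    ClIndep cl B S :=
  fun a ha hmem => hS a ha (h _ hmem)

theorem mk_le_clRK {α : Type*} {cl : Set α → Set α} {A B S : Set α} (hSA : S ⊆ A)
    (hS : ClIndep cl B S) : Cardinal.mk S ≤ ClRK cl A B :=
  le_ciSup (f := fun S : {S : Set α // S ⊆ A ∧ ClIndep cl B S} => Cardinal.mk S.1)
    Cardinal.bddAbove_of_small ⟨S, hSA, hS⟩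

theorem clRK_le_of_cl_subset {α : Type*} {cl cl' : Set α → Set α}
    (h : ∀ X : Set α, cl X ⊆ cl' X) (A B : Set α) : ClRK cl' A B ≤ ClRK cl A B :=
  ciSup_le' fun S => mk_le_clRK S.2.1 (S.2.2.of_cl_subset h)

theorem clRK_singleton_eq_zero {α : Type*} {cl : Set α → Set α}
    {X : Set α} {a : α} (ha : a ∈ cl X) : ClRK cl {a} X = 0 := by
  refine nonpos_iff_eq_zero.mp (ciSup_le' fun ⟨S, hSa, hS⟩ => ?_)
  rcases subset_singleton_iff_eq.mp hSa with rfl | rfl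
  · simp
  · exact absurd ha (by simpa using hS a rfl)

theorem one_le_clRK_singleton {α : Type*} {cl : Set α → Set α} {X : Set α} {a : α}
    (ha : a ∉ cl X) : 1 ≤ ClRK cl {a} X := by
  have hind : ClIndep cl X {a} := by
    rintro b rfl
    simpa using ha
  simpa using mk_le_clRK subset_rfl hind

theorem cl_subset_of_clRK_le {α : Type*} {cl cl' : Set α → Set α}
    (h : ∀ A B : Set α, A.Finite → ClRK cl' A B ≤ ClRK cl A B) (X : Set α) :
    cl X ⊆ cl' X := by
  intro a ha
  by_contra ha'
  have hle := (one_le_clRK_singleton ha').trans (h {a} X (finite_singleton a))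
  rw [clRK_singleton_eq_zero ha] at hle
  exact not_le_of_gt zero_lt_one hle

/-- Comparison of matroids via relative rank: `cl ⊆ cl'` pointwise iff
`RK^{cl}(A/B) ≥ RK^{cl'}(A/B)` for all finite `A` and all `B`; consequently
`cl = cl'` iff `RK^{cl}(A/B) = RK^{cl'}(A/B)` for all finite `A` and all `B`. -/
theorem clRK_comparison {α : Type*} {cl cl' : Set α → Set α}
    (hcl : IsFinMatroid cl) (hcl' : IsFinMatroid cl') :
    ((∀ X : Set α, cl X ⊆ cl' X) ↔
      ∀ (A B : Set α), A.Finite → ClRK cl' A B ≤ ClRK cl A B) ∧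
    ((∀ X : Set α, cl X = cl' X) ↔
      ∀ (A B : Set α), A.Finite → ClRK cl A B = ClRK cl' A B) := by
  refine ⟨⟨fun h A B _ => clRK_le_of_cl_subset h A B, cl_subset_of_clRK_le⟩,
    fun h A B _ => ?_, fun h X => ?_⟩
  · rw [funext h]
  · exact (cl_subset_of_clRK_le (fun A B hA => (h A B hA).ge) X).antisymm
      (cl_subset_of_clRK_le (fun A B hA => (h A B hA).le) X)
end

section
/- Relativisation of a matroid: let cl be a finitary matroid on a type α and X ⊆ α. Define cl_X on subsets of α by cl_X(Y) := cl(X ∪ Y). Then cl_X is a finitary matroid on α, and for all A, B, C ⊆ α, A ⫫_B C holds with respect to the independence relation induced by cl_X if and only if A ⫫_{X ∪ B} C holds with respect to the independence relation induced by cl. -/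
open Set

/-- Relativisation of a matroid: for `X ⊆ α`, the operator `cl_X(Y) := cl(X ∪ Y)`
is a finitary matroid on `α`, and for all `A, B, C`, `A ⫫_B C` with respect to
`cl_X` iff `A ⫫_{X ∪ B} C` with respect to `cl`. -/
theorem isFinMatroid_relativisation {α : Type*} {cl : Set α → Set α}
    (hcl : IsFinMatroid cl) (X : Set α) :
    IsFinMatroid (fun Y : Set α => cl (X ∪ Y)) ∧
    ∀ A B C : Set α,
      ClInd (fun Y : Set α => cl (X ∪ Y)) A B C ↔ ClInd cl A (X ∪ B) C := by
  refine ⟨⟨fun Y => ?_, fun Y Z h => ?_, fun Y => ?_, fun Y => ?_, fun Y a c => ?_⟩,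
    fun A B C => ?_⟩
  · exact subset_union_right.trans (hcl.subset_cl _)
  · exact hcl.mono (union_subset_union_right X h)
  · have hX : X ⊆ cl (X ∪ Y) := subset_union_left.trans (hcl.subset_cl _)
    simp only [union_eq_self_of_subset_left hX, hcl.idem]
  · refine Subset.antisymm (fun a ha => ?_)
      (iUnion₂_subset fun A hA => hcl.mono (union_subset_union_right X hA.1))
    simp only [hcl.finitary (X ∪ Y), mem_iUnion₂] at ha
    obtain ⟨A, ⟨hA, hfin⟩, ha⟩ := ha
    refine mem_iUnion₂.2 ⟨A ∩ Y, ⟨inter_subset_right, hfin.inter_of_left Y⟩,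
      hcl.mono (fun x hx => ?_) ha⟩
    exact (hA hx).imp id fun hy => ⟨hx, hy⟩
  · simp only [← union_assoc]
    exact fun h h' => hcl.exchange h h'
  · simp only [ClInd, ClIndep, union_assoc]
end

section
/- Matroids from dimension functions (Exchange Principle): let L be a first-order language, K an L-structure, and d a dimension function on K. Then the operator cl^d satisfies the Exchange Principle: for every B ⊆ K and all a, c ∈ K, if a ∈ cl^d(B ∪ {c}) and a ∉ cl^d(B), then c ∈ cl^d(B ∪ {a}). -/
open FirstOrder

/-- A dimension function on an `L`-structure `K` (van den Dries):
`d m S` is the dimension of `S ⊆ K^m` (encoded as `Set (Fin m → K)`),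
taking values in `{-∞} ∪ ℕ` (encoded as `WithBot ℕ`), satisfying axioms
(Dim 1)–(Dim 4) on definable sets. For `U ⊆ K^(m+1)` and `x ∈ K^m`, the
section `U_x` is `{t : K | Fin.snoc x t ∈ U}`, and
`U(i) = {x | d(U_x) = i}`. -/
structure DimFunction (L : Language) (K : Type*) [L.Structure K] where
  d : ∀ m : ℕ, Set (Fin m → K) → WithBot ℕ
  /-- (Dim 1) `d S = -∞` iff `S = ∅`, for definable `S`. -/
  dim1_empty : ∀ (m : ℕ), 1 ≤ m → ∀ S : Set (Fin m → K),
    (∃ A : Set K, A.Definable L S) → (d m S = ⊥ ↔ S = ∅)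
  /-- (Dim 1) singletons have dimension `0`. -/
  dim1_singleton : ∀ a : K, d 1 {fun _ => a} = 0
  /-- (Dim 1) `d K = 1`. -/
  dim1_univ : d 1 Set.univ = 1
  /-- (Dim 2) dimension of a union is the max of the dimensions. -/
  dim2 : ∀ (m : ℕ), 1 ≤ m → ∀ S₁ S₂ : Set (Fin m → K),
    (∃ A : Set K, A.Definable L S₁) → (∃ A : Set K, A.Definable L S₂) →
      d m (S₁ ∪ S₂) = max (d m S₁) (d m S₂)
  /-- (Dim 3) dimension is invariant under permutations of coordinates. -/
  dim3 : ∀ (m : ℕ), 1 ≤ m → ∀ (S : Set (Fin m → K)) (σ : Equiv.Perm (Fin m)),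
    (∃ A : Set K, A.Definable L S) →
      d m {x : Fin m → K | x ∘ σ ∈ S} = d m S
  /-- (Dim 4) for definable `U ⊆ K^(m+1)` and `i ∈ {0,1}`, the set
  `U(i) = {x ∈ K^m | d(U_x) = i}` is definable over the same parameter set as `U`. -/
  dim4_definable : ∀ (m : ℕ) (U : Set (Fin (m + 1) → K)) (A : Set K),
    A.Definable L U → ∀ i : Fin 2,
      A.Definable L
        {x : Fin m → K | d 1 {t : Fin 1 → K | Fin.snoc x (t 0) ∈ U} = ((i : ℕ) : WithBot ℕ)}
  /-- (Dim 4) `d (U ∩ π⁻¹(U(i))) = d (U(i)) + i` for `i ∈ {0,1}`, where `π` is the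
  projection onto the first `m` coordinates (with the convention `-∞ + i = -∞`). -/
  dim4_eq : ∀ (m : ℕ) (U : Set (Fin (m + 1) → K)), (∃ A : Set K, A.Definable L U) →
    ∀ i : Fin 2,
      d (m + 1) (U ∩ {f : Fin (m + 1) → K |
          d 1 {t : Fin 1 → K | Fin.snoc (Fin.init f) (t 0) ∈ U} = ((i : ℕ) : WithBot ℕ)}) =
        d m {x : Fin m → K | d 1 {t : Fin 1 → K | Fin.snoc x (t 0) ∈ U} = ((i : ℕ) : WithBot ℕ)}
          + ((i : ℕ) : WithBot ℕ)

/-- The closure operator `cl^d` associated to a dimension function: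
`b ∈ cl^d(A)` iff there is an `A`-definable set `X ⊆ K` with `d X = 0` and `b ∈ X`. -/
def DimFunction.clD {L : Language} {K : Type*} [L.Structure K] (D : DimFunction L K)
    (A : Set K) : Set K :=
  {b : K | ∃ X : Set (Fin 1 → K), A.Definable L X ∧ D.d 1 X = 0 ∧ (fun _ => b) ∈ X}

namespace Set.Definable

variable {L : Language} {K : Type*} [L.Structure K] {A : Set K}

/-- A set definable over `A ∪ {c}` is the section at `c` of a set definable over `A`. -/
theorem exists_section_eq {c : K} {X : Set (Fin 1 → K)} (hX : (A ∪ {c}).Definable L X) :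
    ∃ U : Set (Fin 2 → K), A.Definable L U ∧ ∀ t, ![c, t] ∈ U ↔ (fun _ => t) ∈ X := by
  classical
  obtain ⟨φ, rfl⟩ := Set.definable_iff_exists_formula_sum.1 hX
  let g : ↥(A ∪ {c}) ⊕ Fin 1 → A ⊕ Fin 2 :=
    Sum.elim (fun b => if h : (b : K) ∈ A then Sum.inl ⟨b, h⟩ else Sum.inr 0) fun _ => Sum.inr 1
  refine ⟨_, Set.definable_iff_exists_formula_sum.2 ⟨φ.relabel g, rfl⟩, fun t => ?_⟩
  simp only [Set.mem_ofPred_eq, Language.Formula.realize_relabel]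
  refine iff_of_eq (congrArg _ (funext ?_))
  rintro (⟨b, hb⟩ | i)
  · by_cases h : b ∈ A
    · simp [g, h]
    · have hbc : b = c := hb.resolve_left h
      simp [g, hbc ▸ h, hbc]
  · simp [g]

/-- The section at `a` of a set definable over `A` is definable over `A ∪ {a}`. -/
theorem section_definable {U : Set (Fin 2 → K)} (hU : A.Definable L U) (a : K) :
    (A ∪ {a}).Definable L {t : Fin 1 → K | ![a, t 0] ∈ U} := by
  obtain ⟨φ, rfl⟩ := Set.definable_iff_exists_formula_sum.1 hU
  let g : A ⊕ Fin 2 → ↥(A ∪ {a}) ⊕ Fin 1 :=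
    Sum.elim (fun b => Sum.inl ⟨b, Or.inl b.2⟩) ![Sum.inl ⟨a, Or.inr rfl⟩, Sum.inr 0]
  refine Set.definable_iff_exists_formula_sum.2 ⟨φ.relabel g, ?_⟩
  ext t
  simp only [Set.mem_ofPred_eq, Language.Formula.realize_relabel]
  refine iff_of_eq (congrArg _ (funext ?_))
  rintro (b | i)
  · simp [g]
  · fin_cases i <;> simp [g]

end Set.Definable

namespace DimFunction

variable {L : Language} {K : Type*} [L.Structure K] (D : DimFunction L K)

theorem d_mono {m : ℕ} (hm : 1 ≤ m) {S T : Set (Fin m → K)} {A : Set K} (hS : A.Definable L S)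
    (hT : A.Definable L T) (h : S ⊆ T) : D.d m S ≤ D.d m T := by
  have := D.dim2 m hm S T ⟨A, hS⟩ ⟨A, hT⟩
  rw [Set.union_eq_self_of_subset_left h] at this
  exact this ▸ le_max_left _ _

theorem d_le_one {X : Set (Fin 1 → K)} {A : Set K} (hX : A.Definable L X) : D.d 1 X ≤ 1 :=
  D.dim1_univ ▸ D.d_mono le_rfl hX Set.definable_univ (Set.subset_univ X)

theorem d_eq_zero_or_one {X : Set (Fin 1 → K)} {A : Set K} (hX : A.Definable L X)
    (hne : X.Nonempty) : D.d 1 X = 0 ∨ D.d 1 X = 1 := by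
  have h₁ := D.d_le_one hX
  have h₂ : D.d 1 X ≠ ⊥ := fun h => hne.ne_empty ((D.dim1_empty 1 le_rfl X ⟨A, hX⟩).1 h)
  lift D.d 1 X to ℕ using h₂ with n
  rw [WithBot.coe_le_one] at h₁
  rw [WithBot.coe_eq_zero, WithBot.coe_eq_one]
  lia

/-- The set of points whose fibre in `U` has dimension `i`. -/
def fiberDim (U : Set (Fin 2 → K)) (i : Fin 2) : Set (Fin 1 → K) :=
  {x | D.d 1 {t : Fin 1 → K | ![x 0, t 0] ∈ U} = ((i : ℕ) : WithBot ℕ)}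

theorem snoc_eq (x : Fin 1 → K) (t : K) :
    (Fin.snoc x t : Fin 2 → K) = ![x 0, t] := by
  ext i
  fin_cases i <;> rfl

theorem fiberDim_definable {U : Set (Fin 2 → K)} {A : Set K} (hU : A.Definable L U)
    (i : Fin 2) : A.Definable L (D.fiberDim U i) := by
  have := D.dim4_definable 1 U A hU i
  simp only [snoc_eq] at this
  exact this

theorem d_inter_fiberDim {U : Set (Fin 2 → K)} {A : Set K} (hU : A.Definable L U) (i : Fin 2) :
    D.d 2 (U ∩ {f | (fun _ => f 0) ∈ D.fiberDim U i}) =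
      D.d 1 (D.fiberDim U i) + ((i : ℕ) : WithBot ℕ) := by
  have := D.dim4_eq 1 U ⟨A, hU⟩ i
  simp only [snoc_eq] at this
  exact this

theorem inter_fiberDim_definable {U : Set (Fin 2 → K)} {A : Set K} (hU : A.Definable L U)
    (i : Fin 2) : A.Definable L (U ∩ {f | (fun _ => f 0) ∈ D.fiberDim U i}) :=
  hU.inter ((D.fiberDim_definable hU i).preimage_comp fun _ => 0)

/-- A definable subset of the plane of dimension at most one has few one-dimensional fibres. -/
theorem d_fiberDim_one_le {V : Set (Fin 2 → K)} {A : Set K} (hV : A.Definable L V)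
    (h : D.d 2 V ≤ 1) : D.d 1 (D.fiberDim V 1) ≤ 0 := by
  have h₁ := D.d_inter_fiberDim hV 1
  have h₂ := (D.d_mono one_le_two (D.inter_fiberDim_definable hV 1) hV
    Set.inter_subset_left).trans h
  rw [h₁] at h₂
  generalize D.d 1 (D.fiberDim V 1) = n at h₂
  cases n with
  | bot => exact bot_le
  | coe n =>
    have h₃ : n + 1 ≤ 1 := WithBot.coe_le_coe.1 h₂
    exact WithBot.coe_le_coe.2 (by lia)

end DimFunction

/-- Matroids from dimension functions (Exchange Principle): the operator `cl^d`
associated to a dimension function satisfies the Exchange Principle. -/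
theorem clD_exchange {L : Language} {K : Type*} [L.Structure K] (D : DimFunction L K)
    (B : Set K) (a c : K) (ha : a ∈ D.clD (B ∪ {c})) (ha' : a ∉ D.clD B) :
    c ∈ D.clD (B ∪ {a}) := by
  obtain ⟨X, hX, hX0, haX⟩ := ha
  obtain ⟨U, hU, hUX⟩ := hX.exists_section_eq
  have hc : (fun _ => c) ∈ D.fiberDim U 0 := by
    have : {t : Fin 1 → K | ![c, t 0] ∈ U} = X := by
      ext t
      have ht : (fun _ => t 0) = t := funext fun i => congrArg t (Subsingleton.elim 0 i)
      rw [Set.mem_ofPred_eq, hUX, ht]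
    simpa [DimFunction.fiberDim, this] using hX0
  set W := U ∩ {f | (fun _ => f 0) ∈ D.fiberDim U 0} with hWdef
  have hW : B.Definable L W := D.inter_fiberDim_definable hU 0
  have hcaW : ![c, a] ∈ W := ⟨(hUX a).2 haX, hc⟩
  have hdW : D.d 2 W ≤ 1 := by
    have := D.d_inter_fiberDim hU 0
    rw [hWdef, this]
    simpa using D.d_le_one (D.fiberDim_definable hU 0)
  set V : Set (Fin 2 → K) := {x | x ∘ Equiv.swap 0 1 ∈ W}
  have hV : B.Definable L V := hW.preimage_comp (Equiv.swap 0 1)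
  have hdV : D.d 2 V ≤ 1 := (D.dim3 2 one_le_two W (Equiv.swap 0 1) ⟨B, hW⟩).trans_le hdW
  have hacV : ![a, c] ∈ V := by
    have : ![a, c] ∘ Equiv.swap 0 1 = ![c, a] := by
      ext i
      fin_cases i <;> simp
    simpa [V, this] using hcaW
  have hV1 := D.fiberDim_definable hV 1
  have haV1 : (fun _ => a) ∉ D.fiberDim V 1 := fun h => by
    refine ha' ⟨_, hV1, (D.d_eq_zero_or_one hV1 ⟨_, h⟩).resolve_right fun h₁ => ?_, h⟩
    have := D.d_fiberDim_one_le hV hdV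
    rw [h₁] at this
    exact absurd this (by decide)
  have hVa := hV.section_definable a
  exact ⟨_, hVa, (D.d_eq_zero_or_one hVa ⟨fun _ => c, hacV⟩).resolve_right
    fun h => haV1 (by simpa [DimFunction.fiberDim] using h), hacV⟩
end
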